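/- Let A and B be k-algebras and M a B-A-bimodule which is projective as a B ⊗[k] A^op-module, and let Λ = [[A,0],[M,B]] be the null-square algebra with N = 0 (the triangular matrix algebra, i.e. the trivial square-zero extension of A × B by M). Then for every n ≥ 2 there is an isomorphism of k-vector spaces HH^n(Λ) ≅ HH^n(A) ⊕ HH^n(B). -/

import Mathlib

open scoped TensorProduct
open CategoryTheory MulOpposite

noncomputable section

/-- For a `k`-algebra `R`, `R` is a module over its enveloping algebra `R ⊗[k] Rᵐᵒᵖ`. -/
instance envModule (k R : Type) [Field k] [Ring R] [Algebra k R] :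
    Module (R ⊗[k] Rᵐᵒᵖ) R := TensorProduct.Algebra.module

/-- Hochschild cohomology `HH^n(R) = Ext^n_{R ⊗[k] Rᵐᵒᵖ}(R, R)`, computed in the abelian
category of left modules over the enveloping algebra `R ⊗[k] Rᵐᵒᵖ`. -/
def HH (k : Type) [Field k] (R : Type) [Ring R] [Algebra k R] (n : ℕ) : ModuleCat k :=
  ((Ext k (ModuleCat (R ⊗[k] Rᵐᵒᵖ)) n).obj
    (Opposite.op (ModuleCat.of (R ⊗[k] Rᵐᵒᵖ) R))).obj (ModuleCat.of (R ⊗[k] Rᵐᵒᵖ) R)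

/-- The underlying `k`-vector space of `HH^n`. -/
abbrev HHt (k : Type) [Field k] (R : Type) [Ring R] [Algebra k R] (n : ℕ) : Type :=
  (HH k R n : Type)

section

variable (k A B M : Type) [Field k] [Ring A] [Ring B] [Algebra k A] [Algebra k B]
  [AddCommGroup M] [Module k M] [Module B M] [Module Aᵐᵒᵖ M]
  [SMulCommClass B Aᵐᵒᵖ M] [IsScalarTower k B M] [IsScalarTower k Aᵐᵒᵖ M]

/-- The `B`-`A`-bimodule `M` as a left module over `B ⊗[k] Aᵐᵒᵖ`. -/
instance cornerModule : Module (B ⊗[k] Aᵐᵒᵖ) M := TensorProduct.Algebra.module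

instance cornerTower : IsScalarTower k (B ⊗[k] Aᵐᵒᵖ) M :=
  ⟨fun c x m => by
    show TensorProduct.Algebra.moduleAux (c • x) m = c • TensorProduct.Algebra.moduleAux x m
    rw [map_smul]; rfl⟩

instance : SMulCommClass k (B ⊗[k] Aᵐᵒᵖ) M := IsScalarTower.to_smulCommClass
instance : SMulCommClass (B ⊗[k] Aᵐᵒᵖ) k M := SMulCommClass.symm _ _ _

/-- Left action of `A × B` on the corner bimodule `M`: `(a,b) • m = b • m`. -/
instance instLeftM : Module (A × B) M := Module.compHom M (RingHom.snd A B)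

/-- Right action of `A × B` on `M`: `op (a,b) • m = op a • m`. -/
instance instRightM : Module (A × B)ᵐᵒᵖ M :=
  Module.compHom M (RingHom.op (RingHom.fst A B))

instance : SMulCommClass (A × B) (A × B)ᵐᵒᵖ M :=
  ⟨fun p q m => show p.2 • (op q.unop.1) • m = (op q.unop.1) • p.2 • m from
    smul_comm p.2 (op q.unop.1) m⟩

instance : IsScalarTower k (A × B) M := ⟨fun c p m => smul_assoc c p.2 m⟩

instance : IsScalarTower k (A × B)ᵐᵒᵖ M := ⟨fun c p m => smul_assoc c (op p.unop.1) m⟩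

/-- The triangular matrix algebra `Λ = [[A,0],[M,B]]`, i.e. the trivial square-zero
extension of `A × B` by the `(A × B)`-bimodule `M` (with `N = 0`), where
`(a,b) • m = b • m` and `m • (a,b) = m • a`. -/
abbrev Tri : Type := TrivSqZeroExt (A × B) M

section Part1
universe v u
variable {k : Type} [Field k] {C : Type u} [Category.{v} C] [Abelian C] [Linear k C] [EnoughProjectives C] [HasExt.{v} C]

def HomC {X : C} (P : ProjectiveResolution X) (Y : C) (n : ℕ) :
    Submodule k (P.complex.X (n+1) ⟶ Y) where
  carrier := {f | P.complex.d (n+2) (n+1) ≫ f = 0}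
  add_mem' {a b} ha hb := by
    simp only [Set.mem_ofPred_eq] at *; simp [ha, hb]
  zero_mem' := by simp
  smul_mem' c f hf := by
    simp only [Set.mem_ofPred_eq] at *; simp [hf]

def toNew {X : C} (P : ProjectiveResolution X) (Y : C) (n : ℕ) :
    HomC (k := k) P Y n →ₗ[k] Abelian.Ext.{v} X Y (n+1) where
  toFun f := P.extMk f.1 (n+2) rfl f.2
  map_add' f g := (P.add_extMk _ _ _ _ f.2 g.2).symm
  map_smul' r f := by
    have h := P.extMk_comp_mk₀ f.1 (n+2) rfl f.2 (r • 𝟙 Y)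
    have h2 := Abelian.Ext.smul_eq_comp_mk₀ (P.extMk f.1 (n+2) rfl f.2) r
    refine Eq.trans ?_ (h.symm.trans h2.symm)
    congr 1
    simp

theorem old_new (X Y : C) (n : ℕ) :
  Nonempty ((((Ext k C (n+1)).obj (Opposite.op X)).obj Y : Type v) ≃ₗ[k] Abelian.Ext.{v} X Y (n+1)) := by
  let P : ProjectiveResolution X := ProjectiveResolution.of X
  let e := (P.isoExt (R := k) (n+1) Y) ≪≫ HomologicalComplex.homologyIsoSc' (P.complex.linearYonedaObj k Y) n (n+1) (n+2) (by simp) (by simp) ≪≫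
    ShortComplex.moduleCatHomologyIso _
  let S := (P.complex.linearYonedaObj k Y).sc' n (n+1) (n+2)
  have hs : Function.Surjective (toNew (k := k) P Y n) := by
    intro α
    obtain ⟨f, hf, h⟩ := P.extMk_surjective α (n+2) rfl
    exact ⟨⟨f, hf⟩, h⟩
  have e2 : (S.moduleCatLeftHomologyData.H : Type v) ≃ₗ[k] (HomC (k := k) P Y n ⧸ LinearMap.ker (toNew (k := k) P Y n)) := by
    refine Submodule.Quotient.equiv _ _ (LinearEquiv.ofEq (LinearMap.ker S.g.hom) (HomC (k := k) P Y n) ?_) ?_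
    · ext f; rfl
    · ext f
      have := P.extMk_eq_zero_iff f.1 (n+2) rfl f.2 n rfl
      rw [LinearMap.mem_ker]
      refine Iff.trans ?_ this.symm
      constructor
      · rintro ⟨y, ⟨g, hg⟩, h⟩
        exact ⟨g, by rw [← h, ← hg]; rfl⟩
      · rintro ⟨g, hg⟩
        exact ⟨⟨f.1, f.2⟩, ⟨g, Subtype.ext hg⟩, rfl⟩
  exact ⟨(e.toLinearEquiv.trans e2).trans ((toNew (k := k) P Y n).quotKerEquivOfSurjective hs)⟩
end Part1

section Part2
universe v u v' u'
variable {k : Type} [Field k] {C : Type u} [Category.{v} C] [Abelian C] [Linear k C] [HasExt.{v} C]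
variable {D : Type u'} [Category.{v'} D] [Abelian D] [Linear k D] [HasExt.{v'} D]
open Abelian

def preL {X X' Y : C} {a b c : ℕ} (α : Ext.{v} X X' a) (h : a + b = c) : Ext.{v} X' Y b →ₗ[k] Ext.{v} X Y c where
  toFun β := α.comp β h
  map_add' := by simp
  map_smul' := by simp

def postL {X X' Y : C} {a b c : ℕ} (β : Ext.{v} X' Y b) (h : a + b = c) : Ext.{v} X X' a →ₗ[k] Ext.{v} X Y c where
  toFun α := α.comp β h
  map_add' := by simp
  map_smul' := by simp

theorem contra_iso {S : ShortComplex C} (hS : S.ShortExact) [Projective S.X₁] (Y : C) (n : ℕ) :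
    Nonempty (Ext.{v} S.X₃ Y (n+2) ≃ₗ[k] Ext.{v} S.X₂ Y (n+2)) := by
  refine ⟨LinearEquiv.ofBijective (preL (Ext.mk₀ S.g) (zero_add _)) ⟨?_, ?_⟩⟩
  · rw [injective_iff_map_eq_zero]
    intro x hx
    obtain ⟨y, hy⟩ := Ext.contravariant_sequence_exact₃ hS Y x hx (n₀ := n+1) (by omega)
    rw [← hy, Ext.eq_zero_of_projective y, Ext.comp_zero]
  · intro x
    obtain ⟨y, hy⟩ := Ext.contravariant_sequence_exact₂ hS Y x (Ext.eq_zero_of_projective _)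
    exact ⟨y, hy⟩

theorem prod_iso {X P Q : C} (i : P ⟶ X) (j : Q ⟶ X) (p : X ⟶ P) (q : X ⟶ Q)
    (h1 : i ≫ p = 𝟙 _) (h2 : j ≫ q = 𝟙 _) (h3 : i ≫ q = 0) (h4 : j ≫ p = 0) (h5 : p ≫ i + q ≫ j = 𝟙 _)
    (Y : C) (n : ℕ) :
    Nonempty (Ext.{v} X Y n ≃ₗ[k] (Ext.{v} P Y n × Ext.{v} Q Y n)) := by
  let f : Ext.{v} X Y n →ₗ[k] (Ext.{v} P Y n × Ext.{v} Q Y n) :=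
    LinearMap.prod (preL (Ext.mk₀ i) (zero_add _)) (preL (Ext.mk₀ j) (zero_add _))
  let g : (Ext.{v} P Y n × Ext.{v} Q Y n) →ₗ[k] Ext.{v} X Y n :=
    LinearMap.coprod (preL (Ext.mk₀ p) (zero_add _)) (preL (Ext.mk₀ q) (zero_add _))
  have key : ∀ {U V W : C} (u : U ⟶ V) (w : V ⟶ W) (x : Ext.{v} W Y n),
      (Ext.mk₀ u).comp ((Ext.mk₀ w).comp x (zero_add n)) (zero_add n) =
        (Ext.mk₀ (u ≫ w)).comp x (zero_add n) := by
    intro U V W u w x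
    rw [← Ext.mk₀_comp_mk₀, Ext.comp_assoc_of_second_deg_zero]
  refine ⟨LinearEquiv.ofLinearMap f g ?_ ?_⟩
  · apply LinearMap.ext
    rintro ⟨x, y⟩
    simp [f, g, preL, key, h1, h2, h3, h4]
  · apply LinearMap.ext
    intro x
    have : (Ext.mk₀ (p ≫ i)).comp x (zero_add n) + (Ext.mk₀ (q ≫ j)).comp x (zero_add n) = x := by
      rw [← Ext.add_comp, ← Ext.mk₀_add, h5, Ext.mk₀_id_comp]
    simpa [f, g, preL, key] using this

theorem ext_congr (X : C) {Y Y' : C} (e : Y ≅ Y') (n : ℕ) : Nonempty (Ext.{v} X Y n ≃ₗ[k] Ext.{v} X Y' n) := by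
  refine ⟨LinearEquiv.ofLinearMap (postL (Ext.mk₀ e.hom) (add_zero _)) (postL (Ext.mk₀ e.inv) (add_zero _)) ?_ ?_⟩
  · apply LinearMap.ext
    intro x
    simp [postL]
  · apply LinearMap.ext
    intro x
    simp [postL]

theorem shift_one {S : ShortComplex C} (hS : S.ShortExact) [Injective S.X₂] (X : C) :
    Nonempty (((X ⟶ S.X₃) ⧸ LinearMap.range (Linear.rightComp k X S.g)) ≃ₗ[k] Ext.{v} X S.X₁ 1) := by
  let f : (X ⟶ S.X₃) →ₗ[k] Ext.{v} X S.X₁ 1 := (postL hS.extClass (zero_add 1)).comp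
    (Ext.linearEquiv₀ (R := k)).symm.toLinearMap
  have hf : Function.Surjective f := by
    intro x
    obtain ⟨y, hy⟩ := Ext.covariant_sequence_exact₁ X hS x (Ext.eq_zero_of_injective _) (zero_add 1)
    exact ⟨Ext.linearEquiv₀ (R := k) y, by simpa [f, postL] using hy⟩
  have hk : LinearMap.range (Linear.rightComp k X S.g) = LinearMap.ker f := by
    ext x
    constructor
    · rintro ⟨y, rfl⟩
      have : (Ext.linearEquiv₀ (R := k)).symm (y ≫ S.g) = Ext.mk₀ (y ≫ S.g) := rfl
      simp [f, postL, this, ← Ext.mk₀_comp_mk₀, Ext.comp_assoc_of_second_deg_zero]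
    · intro hx
      obtain ⟨y, hy⟩ := Ext.covariant_sequence_exact₃ X hS _ (zero_add 1) hx
      refine ⟨Ext.linearEquiv₀ (R := k) y, ?_⟩
      apply (Ext.linearEquiv₀ (R := k)).symm.injective
      refine Eq.trans ?_ hy
      have : ∀ z : X ⟶ S.X₃, (Ext.linearEquiv₀ (R := k)).symm z = Ext.mk₀ z := fun _ => rfl
      rw [this, Linear.rightComp_apply, ← Ext.mk₀_comp_mk₀, Ext.mk₀_linearEquiv₀_apply]
  exact ⟨(Submodule.quotEquivOfEq _ _ hk).trans (f.quotKerEquivOfSurjective hf)⟩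

theorem shift_succ {S : ShortComplex C} (hS : S.ShortExact) [Injective S.X₂] (X : C) (n : ℕ) :
    Nonempty (Ext.{v} X S.X₃ (n+1) ≃ₗ[k] Ext.{v} X S.X₁ (n+2)) := by
  refine ⟨LinearEquiv.ofBijective (postL hS.extClass rfl) ⟨?_, ?_⟩⟩
  · rw [injective_iff_map_eq_zero]
    intro x hx
    obtain ⟨y, hy⟩ := Ext.covariant_sequence_exact₃ X hS x rfl hx
    rw [← hy, Ext.eq_zero_of_injective y, Ext.zero_comp]
  · intro x
    obtain ⟨y, hy⟩ := Ext.covariant_sequence_exact₁ X hS x (Ext.eq_zero_of_injective _) rfl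
    exact ⟨y, hy⟩

theorem ext_adj (G : C ⥤ D) [G.PreservesZeroMorphisms]
    (hG : ∀ S : ShortComplex C, S.ShortExact → (S.map G).ShortExact)
    (X0 : C) (X1 : D) (e : ∀ Y : C, (X0 ⟶ Y) ≃ₗ[k] (X1 ⟶ G.obj Y))
    (he : ∀ (Y Z : C) (f : X0 ⟶ Y) (g : Y ⟶ Z), e Z (f ≫ g) = e Y f ≫ G.map g)
    (hJ : ∀ Y : C, ∃ (J : C) (i : Y ⟶ J), Mono i ∧ Injective J ∧ Injective (G.obj J)) (n : ℕ) :
    ∀ Y : C, Nonempty (Ext.{v} X0 Y (n+1) ≃ₗ[k] Ext.{v'} X1 (G.obj Y) (n+1)) := by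
  induction n with
  | zero =>
    intro Y
    obtain ⟨J, i, hi, h1, h2⟩ := hJ Y
    let S := ShortComplex.mk i (Limits.cokernel.π i) (Limits.cokernel.condition i)
    have hS : S.ShortExact := { exact := ShortComplex.exact_cokernel i }
    have : Injective S.X₂ := h1
    have : Injective (S.map G).X₂ := h2
    obtain ⟨a⟩ := shift_one (k := k) hS X0
    obtain ⟨b⟩ := shift_one (k := k) (hG S hS) X1
    refine ⟨(a.symm.trans (Submodule.Quotient.equiv _ _ (e S.X₃) ?_)).trans b⟩
    ext x
    constructor
    · rintro ⟨_, ⟨y, rfl⟩, rfl⟩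
      exact ⟨e _ y, (he _ _ _ _).symm⟩
    · rintro ⟨y, rfl⟩
      refine ⟨_, ⟨(e _).symm y, rfl⟩, ?_⟩
      refine (he _ _ _ _).trans ?_
      exact congrArg (fun z => z ≫ G.map S.g) ((e S.X₂).apply_symm_apply y)
  | succ n ih =>
    intro Y
    obtain ⟨J, i, hi, h1, h2⟩ := hJ Y
    let S := ShortComplex.mk i (Limits.cokernel.π i) (Limits.cokernel.condition i)
    have hS : S.ShortExact := { exact := ShortComplex.exact_cokernel i }
    have : Injective S.X₂ := h1
    have : Injective (S.map G).X₂ := h2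
    obtain ⟨a⟩ := shift_succ (k := k) hS X0 n
    obtain ⟨b⟩ := shift_succ (k := k) (hG S hS) X1 n
    obtain ⟨c⟩ := ih S.X₃
    exact ⟨(a.symm.trans c).trans b⟩
end Part2

section Part3
variable {k R E : Type} [Field k] [Ring R] [Ring E] [Algebra k R] [Algebra k E]

/-- corner of a module -/
def cor (ι : R →ₙₐ[k] E) (N : Type) [AddCommGroup N] [Module E N] : AddSubgroup N where
  carrier := {y | ι 1 • y = y}
  add_mem' {a b} ha hb := by
    simp only [Set.mem_ofPred_eq] at *; rw [smul_add, ha, hb]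
  zero_mem' := by simp
  neg_mem' {a} ha := by
    simp only [Set.mem_ofPred_eq] at *; rw [smul_neg, ha]

theorem mem_cor (ι : R →ₙₐ[k] E) {N : Type} [AddCommGroup N] [Module E N] (y : N) :
    y ∈ cor ι N ↔ ι 1 • y = y := Iff.rfl

theorem smul_mem_cor (ι : R →ₙₐ[k] E) {N : Type} [AddCommGroup N] [Module E N] (r : R) (y : N) :
    ι r • y ∈ cor ι N := by
  rw [mem_cor, ← mul_smul, ← map_mul, one_mul]

instance corModule (ι : R →ₙₐ[k] E) (N : Type) [AddCommGroup N] [Module E N] : Module R (cor ι N) where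
  smul r y := ⟨ι r • y.1, smul_mem_cor ι r y.1⟩
  one_smul y := Subtype.ext y.2
  mul_smul r s y := Subtype.ext (show ι (r * s) • y.1 = ι r • ι s • y.1 by rw [map_mul, mul_smul])
  smul_zero r := Subtype.ext (smul_zero (ι r))
  smul_add r x y := Subtype.ext (smul_add (ι r) x.1 y.1)
  add_smul r s x := Subtype.ext (show ι (r + s) • x.1 = ι r • x.1 + ι s • x.1 by rw [map_add, add_smul])
  zero_smul x := Subtype.ext (show ι 0 • x.1 = 0 by rw [map_zero, zero_smul])

theorem cor_smul_val (ι : R →ₙₐ[k] E) {N : Type} [AddCommGroup N] [Module E N] (r : R) (y : cor ι N) :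
    (r • y).1 = ι r • y.1 := rfl

def corMap (ι : R →ₙₐ[k] E) {N N' : Type} [AddCommGroup N] [Module E N] [AddCommGroup N'] [Module E N']
    (f : N →ₗ[E] N') : cor ι N →ₗ[R] cor ι N' where
  toFun y := ⟨f y.1, by rw [mem_cor, ← map_smul, y.2]⟩
  map_add' x y := Subtype.ext (map_add f _ _)
  map_smul' r x := Subtype.ext (map_smul f _ _)

def corF (ι : R →ₙₐ[k] E) : ModuleCat.{0} E ⥤ ModuleCat.{0} R where
  obj N := ModuleCat.of R (cor ι N)
  map f := ModuleCat.ofHom (corMap ι f.hom)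
  map_id _ := rfl
  map_comp _ _ := rfl

instance (ι : R →ₙₐ[k] E) : (corF ι).PreservesZeroMorphisms where
  map_zero _ _ := rfl

theorem corF_exact (ι : R →ₙₐ[k] E) (S : ShortComplex (ModuleCat.{0} E)) (hS : S.ShortExact) :
    (S.map (corF ι)).ShortExact := by
  have h1 := (ModuleCat.mono_iff_injective _).1 hS.mono_f
  have h2 := (ModuleCat.epi_iff_surjective _).1 hS.epi_g
  have h3 := (ShortComplex.moduleCat_exact_iff S).1 hS.exact
  refine { exact := ?_, mono_f := ?_, epi_g := ?_ }
  · rw [ShortComplex.moduleCat_exact_iff]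
    rintro ⟨x, hx⟩ h
    obtain ⟨y, hy⟩ := h3 x (congrArg Subtype.val h)
    refine ⟨⟨y, h1 ?_⟩, Subtype.ext hy⟩
    refine (map_smul S.f.hom _ _).trans ?_
    rw [hy]; exact hx
  · rw [ModuleCat.mono_iff_injective]
    intro x y hxy
    exact Subtype.ext (h1 (congrArg Subtype.val hxy))
  · rw [ModuleCat.epi_iff_surjective]
    rintro ⟨x, hx⟩
    obtain ⟨y, rfl⟩ := h2 x
    refine ⟨⟨ι 1 • y, smul_mem_cor ι 1 y⟩, Subtype.ext ?_⟩
    exact (map_smul S.g.hom _ _).trans hx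

def Good (ι : R →ₙₐ[k] E) : Prop :=
  ∃ (V : Type) (_ : AddCommGroup V) (_ : Module k V) (i : E →ₗ[k] V ⊗[k] R) (p : V ⊗[k] R →ₗ[k] E),
    (∀ t r, i (t * ι r) = LinearMap.lTensor V (LinearMap.mulRight k r) (i t)) ∧
    (∀ v c, p (v ⊗ₜ c) = p (v ⊗ₜ 1) * ι c) ∧ ∀ t, p (i t) = t * ι 1

def Coind (k E Y : Type) [Field k] [Ring E] [Algebra k E] [AddCommGroup Y] [Module k Y] := E →ₗ[k] Y

instance (Y : Type) [AddCommGroup Y] [Module k Y] : AddCommGroup (Coind k E Y) :=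
  inferInstanceAs (AddCommGroup (E →ₗ[k] Y))

instance (Y : Type) [AddCommGroup Y] [Module k Y] : FunLike (Coind k E Y) E Y :=
  inferInstanceAs (FunLike (E →ₗ[k] Y) E Y)

instance (Y : Type) [AddCommGroup Y] [Module k Y] : LinearMapClass (Coind k E Y) k E Y :=
  inferInstanceAs (LinearMapClass (E →ₗ[k] Y) k E Y)

theorem Coind.ext' {Y : Type} [AddCommGroup Y] [Module k Y] {f g : Coind k E Y} (h : ∀ x, f x = g x) : f = g :=
  LinearMap.ext h

instance coindModule (Y : Type) [AddCommGroup Y] [Module k Y] : Module E (Coind k E Y) where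
  smul x f := LinearMap.comp (show E →ₗ[k] Y from f) (LinearMap.mulRight k x)
  one_smul f := Coind.ext' fun t => show f (t * 1) = f t by rw [mul_one]
  mul_smul x y f := Coind.ext' fun t => show f (t * (x * y)) = f (t * x * y) by rw [mul_assoc]
  smul_zero x := rfl
  smul_add x f g := rfl
  add_smul x y f := Coind.ext' fun t => show f (t * (x + y)) = f (t * x) + f (t * y) by
    rw [mul_add, map_add]
  zero_smul f := Coind.ext' fun t => show f (t * 0) = 0 by rw [mul_zero, map_zero]

theorem coind_smul (Y : Type) [AddCommGroup Y] [Module k Y] (x t : E) (f : Coind k E Y) :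
   (x • f) t = f (t * x) := rfl

theorem lin_extend {X' X Y : Type} [AddCommGroup X'] [AddCommGroup X] [AddCommGroup Y] [Module k X'] [Module k X]
    [Module k Y] (f : X' →ₗ[k] X) (hf : Function.Injective f) (g : X' →ₗ[k] Y) :
    ∃ h : X →ₗ[k] Y, ∀ x, h (f x) = g x := by
  obtain ⟨l, hl⟩ := f.exists_leftInverse_of_injective (LinearMap.ker_eq_bot.2 hf)
  refine ⟨g.comp l, fun x => ?_⟩
  have := LinearMap.congr_fun hl x
  simp only [LinearMap.comp_apply, LinearMap.id_apply] at this ⊢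
  rw [this]

theorem coind_inj (Y : Type) [AddCommGroup Y] [Module k Y] : Module.Injective.{0,0} E (Coind k E Y) where
  out X' X _ _ _ _ f hf g := by
    let _ : Module k X' := Module.compHom X' (algebraMap k E)
    let _ : Module k X := Module.compHom X (algebraMap k E)
    have st' : ∀ (c : k) (x : X'), c • x = algebraMap k E c • x := fun _ _ => rfl
    have st : ∀ (c : k) (x : X), c • x = algebraMap k E c • x := fun _ _ => rfl
    let f' : X' →ₗ[k] X := { toFun := f, map_add' := map_add f, map_smul' := fun c x => map_smul f _ _ }
    let g' : X' →ₗ[k] Y :=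
      { toFun := fun x => g x 1
        map_add' := fun x y => by rw [map_add]; rfl
        map_smul' := fun c x => by
          rw [st', map_smul, coind_smul, one_mul, Algebra.algebraMap_eq_smul_one, map_smul]; rfl }
    obtain ⟨h, hh⟩ := lin_extend f' hf g'
    refine ⟨{ toFun := fun x => (LinearMap.mk ⟨fun t => h (t • x), ?_⟩ ?_ : E →ₗ[k] Y), map_add' := ?_, map_smul' := ?_ }, ?_⟩
    · intro s t; rw [add_smul, map_add]
    · intro c t
      simp only [RingHom.id_apply]
      rw [← map_smul, st, smul_smul, Algebra.smul_def]
    · intro x y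
      exact Coind.ext' fun t => show h (t • (x + y)) = h (t • x) + h (t • y) by rw [smul_add, map_add]
    · intro r x
      exact Coind.ext' fun t => show h (t • (r • x)) = h ((t * r) • x) by rw [smul_smul]
    · intro x
      refine Coind.ext' fun t => show h (t • f x) = g x t from ?_
      rw [← map_smul]
      refine (hh _).trans ?_
      show g (t • x) 1 = _
      rw [map_smul, coind_smul, one_mul]

theorem cor_coind_inj (ι : R →ₙₐ[k] E) (hι : Good ι) (Y : Type) [AddCommGroup Y] [Module k Y] :
    Module.Injective.{0,0} R (cor ι (Coind k E Y)) where
  out X' X _ _ _ _ f hf φ := by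
    let _ : Module k X' := Module.compHom X' (algebraMap k R)
    let _ : Module k X := Module.compHom X (algebraMap k R)
    have st' : ∀ (c : k) (x : X'), c • x = algebraMap k R c • x := fun _ _ => rfl
    have st : ∀ (c : k) (x : X), c • x = algebraMap k R c • x := fun _ _ => rfl
    obtain ⟨V, _, _, i, p, h1, h2, h3⟩ := hι
    let f' : X' →ₗ[k] X := { toFun := f, map_add' := map_add f, map_smul' := fun c x => map_smul f _ _ }
    have hφ : ∀ (r : R) (x : X') (t : E), (φ (r • x)).1 t = (φ x).1 (t * ι r) := by
      intro r x t
      rw [map_smul, cor_smul_val, coind_smul]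
    have hφ1 : ∀ (x : X') (t : E), (φ x).1 (t * ι 1) = (φ x).1 t := by
      intro x t
      rw [← hφ, one_smul]
    let g' : X' →ₗ[k] (V →ₗ[k] Y) := LinearMap.mk₂ k (fun x v => (φ x).1 (p (v ⊗ₜ 1)))
      (fun x y v => by rw [map_add]; rfl)
      (fun c x v => by
        rw [st', hφ, ← h2, Algebra.algebraMap_eq_smul_one, TensorProduct.tmul_smul, map_smul, map_smul])
      (fun x v w => by rw [TensorProduct.add_tmul, map_add, map_add])
      (fun c x v => by rw [← TensorProduct.smul_tmul', map_smul, map_smul])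
    obtain ⟨ψ, hψ⟩ := lin_extend f' hf g'
    let Ψ : X → (V ⊗[k] R →ₗ[k] Y) := fun x => TensorProduct.lift (LinearMap.mk₂ k (fun v r => ψ (r • x) v)
      (fun v w r => by rw [map_add])
      (fun c v r => by rw [map_smul])
      (fun v r s => by rw [add_smul, map_add]; rfl)
      (fun c v r => by rw [Algebra.smul_def, mul_smul, ← st, map_smul]; rfl))
    have hΨ : ∀ x v r, Ψ x (v ⊗ₜ r) = ψ (r • x) v := fun x v r => by
      simp [Ψ]
    have hΨ1 : ∀ x r w, Ψ (r • x) w = Ψ x (LinearMap.lTensor V (LinearMap.mulRight k r) w) := by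
      intro x r w
      induction w using TensorProduct.induction_on with
      | zero => simp
      | tmul v s => rw [LinearMap.lTensor_tmul, hΨ, hΨ, smul_smul]; rfl
      | add a b ha hb => simp only [map_add, ha, hb]
    have hΨ2 : ∀ x y w, Ψ (x + y) w = Ψ x w + Ψ y w := by
      intro x y w
      induction w using TensorProduct.induction_on with
      | zero => simp
      | tmul v s => rw [hΨ, hΨ, hΨ, smul_add, map_add]; rfl
      | add a b ha hb => simp only [map_add, ha, hb]; abel
    have hΨ3 : ∀ x w, Ψ (f x) w = (φ x).1 (p w) := by
      intro x w
      induction w using TensorProduct.induction_on with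
      | zero => simp
      | tmul v s =>
        rw [hΨ, h2, ← hφ, ← map_smul]
        exact LinearMap.congr_fun (hψ (s • x)) v
      | add a b ha hb => simp only [map_add, ha, hb]
    have hΨ4 : ∀ x r t, Ψ x (i (t * ι r)) = Ψ (r • x) (i t) := by
      intro x r t
      rw [h1, hΨ1]
    refine ⟨{ toFun := fun x => ⟨(Ψ x).comp i, ?_⟩, map_add' := ?_, map_smul' := ?_ }, ?_⟩
    · exact Coind.ext' fun t => show Ψ x (i (t * ι 1)) = Ψ x (i t) by rw [hΨ4, one_smul]
    · intro x y
      exact Subtype.ext (Coind.ext' fun t => hΨ2 x y _)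
    · intro r x
      exact Subtype.ext (Coind.ext' fun t => (hΨ4 x r t).symm)
    · intro x
      refine Subtype.ext (Coind.ext' fun t => ?_)
      show Ψ (f x) (i t) = (φ x).1 t
      rw [hΨ3, h3, hφ1]

theorem corF_embed (ι : R →ₙₐ[k] E) (hι : Good ι) (Y : ModuleCat.{0} E) :
    ∃ (J : ModuleCat.{0} E) (i : Y ⟶ J), Mono i ∧ Injective J ∧ Injective ((corF ι).obj J) := by
  let _ : Module k Y := Module.compHom Y (algebraMap k E)
  have st : ∀ (c : k) (x : Y), c • x = algebraMap k E c • x := fun _ _ => rfl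
  have a1 := coind_inj (k := k) (E := E) Y
  have a2 := cor_coind_inj ι hι Y
  let i : Y →ₗ[E] Coind k E Y :=
    { toFun := fun y => (LinearMap.mk ⟨fun t => t • y, fun s t => add_smul _ _ _⟩
        (fun c t => by simp only [RingHom.id_apply]; rw [st, smul_smul, Algebra.smul_def]) : E →ₗ[k] Y)
      map_add' := fun x y => Coind.ext' fun t => smul_add t x y
      map_smul' := fun r x => Coind.ext' fun t => smul_smul t r x }
  refine ⟨ModuleCat.of E (Coind k E Y), ModuleCat.ofHom i, ?_, ?_, ?_⟩
  · rw [ModuleCat.mono_iff_injective]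
    intro x y hxy
    have := DFunLike.congr_fun (F := Coind k E Y) hxy 1
    have h : (1 : E) • x = (1 : E) • y := this
    simpa using h
  · exact Module.injective_object_of_injective_module E _
  · exact Module.injective_object_of_injective_module R (cor ι (Coind k E Y))

/-- The comparison. -/
theorem corner_ext (ι : R →ₙₐ[k] E) (hι : Good ι) (X0 X1 : Type) [AddCommGroup X0] [Module E X0]
    [AddCommGroup X1] [Module R X1] (u : X1 →ₗ[R] cor ι X0)
    (hu : ∀ (Y : Type) [AddCommGroup Y] [Module E Y] (g : X1 →ₗ[R] cor ι Y),
      ∃! f : X0 →ₗ[E] Y, ∀ x, f (u x).1 = (g x).1) (Y : Type) [AddCommGroup Y] [Module E Y]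
    (Y1 : Type) [AddCommGroup Y1] [Module R Y1] (eY : cor ι Y ≃ₗ[R] Y1) (n : ℕ) :
    Nonempty (Abelian.Ext.{0} (ModuleCat.of E X0) (ModuleCat.of E Y) (n+1) ≃ₗ[k]
      Abelian.Ext.{0} (ModuleCat.of R X1) (ModuleCat.of R Y1) (n+1)) := by
  let e : ∀ Y : ModuleCat.{0} E, (ModuleCat.of E X0 ⟶ Y) →ₗ[k] (ModuleCat.of R X1 ⟶ (corF ι).obj Y) := fun Y =>
    { toFun := fun f => ModuleCat.ofHom ((corMap ι f.hom).comp u)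
      map_add' := fun f g => rfl
      map_smul' := fun c f => by
        ext x
        have hz : ι 1 • f.hom (u x).1 = f.hom (u x).1 := (corMap ι f.hom (u x)).2
        show algebraMap k E c • f.hom (u x).1 = ι (algebraMap k R c) • f.hom (u x).1
        rw [Algebra.algebraMap_eq_smul_one (A := R) c, map_smul, Algebra.smul_def, mul_smul, hz] }
  have he : ∀ Y, Function.Bijective (e Y) := by
    intro Y
    constructor
    · intro f g hfg
      obtain ⟨h, h1, h2⟩ := hu Y ((corMap ι f.hom).comp u)
      refine ModuleCat.hom_ext ((h2 f.hom fun x => rfl).trans (h2 g.hom fun x => ?_).symm)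
      have := LinearMap.congr_fun (congrArg ModuleCat.Hom.hom hfg) x
      exact (congrArg Subtype.val this).symm
    · intro g
      obtain ⟨h, h1, h2⟩ := hu Y g.hom
      refine ⟨ModuleCat.ofHom h, ?_⟩
      ext x
      exact Subtype.ext (h1 x)
  obtain ⟨w⟩ := ext_adj (k := k) (corF ι) (corF_exact ι) _ _ (fun Y => LinearEquiv.ofBijective (e Y) (he Y))
    (fun _ _ _ _ => rfl) (corF_embed ι hι) n (ModuleCat.of E Y)
  obtain ⟨w'⟩ := ext_congr (k := k) (ModuleCat.of R X1) (eY.toModuleIso) (n+1)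
  exact ⟨w.trans w'⟩
end Part3

section Part4
variable {k R₁ E₁ R₂ E₂ : Type} [Field k] [Ring R₁] [Ring E₁] [Algebra k R₁] [Algebra k E₁]
   [Ring R₂] [Ring E₂] [Algebra k R₂] [Algebra k E₂]

def tens (ι₁ : R₁ →ₙₐ[k] E₁) (ι₂ : R₂ →ₙₐ[k] E₂) : R₁ ⊗[k] R₂ →ₙₐ[k] E₁ ⊗[k] E₂ :=
  { TensorProduct.map (ι₁ : R₁ →ₗ[k] E₁) (ι₂ : R₂ →ₗ[k] E₂) with
    map_zero' := map_zero (TensorProduct.map (ι₁ : R₁ →ₗ[k] E₁) (ι₂ : R₂ →ₗ[k] E₂))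
    map_mul' := by
      intro x y
      show TensorProduct.map (ι₁ : R₁ →ₗ[k] E₁) (ι₂ : R₂ →ₗ[k] E₂) (x * y) =
        TensorProduct.map (ι₁ : R₁ →ₗ[k] E₁) (ι₂ : R₂ →ₗ[k] E₂) x *
        TensorProduct.map (ι₁ : R₁ →ₗ[k] E₁) (ι₂ : R₂ →ₗ[k] E₂) y
      induction x using TensorProduct.induction_on with
      | zero => simp
      | add a b ha hb => simp only [add_mul, map_add, ha, hb]
      | tmul a b =>
        induction y using TensorProduct.induction_on with
        | zero => simp
        | add a b ha hb => simp only [mul_add, map_add, ha, hb]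
        | tmul c d => simp }

theorem tens_tmul (ι₁ : R₁ →ₙₐ[k] E₁) (ι₂ : R₂ →ₙₐ[k] E₂) (a : R₁) (b : R₂) :
    tens ι₁ ι₂ (a ⊗ₜ b) = ι₁ a ⊗ₜ ι₂ b := rfl

theorem good_tens (ι₁ : R₁ →ₙₐ[k] E₁) (ι₂ : R₂ →ₙₐ[k] E₂) (h₁ : Good ι₁) (h₂ : Good ι₂) :
    Good (tens ι₁ ι₂) := by
  obtain ⟨V, _, _, i, p, a1, a2, a3⟩ := h₁
  obtain ⟨W, _, _, j, q, b1, b2, b3⟩ := h₂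
  refine ⟨V ⊗[k] W, inferInstance, inferInstance,
    (TensorProduct.tensorTensorTensorComm k V R₁ W R₂).toLinearMap.comp (TensorProduct.map i j),
    (TensorProduct.map p q).comp (TensorProduct.tensorTensorTensorComm k V W R₁ R₂).toLinearMap, ?_, ?_, ?_⟩
  · intro t r
    induction r using TensorProduct.induction_on with
    | zero =>
      rw [map_zero, mul_zero, map_zero, show LinearMap.mulRight k (0 : R₁ ⊗[k] R₂) = 0 by ext; simp]
      simp
    | add x y hx hy =>
      rw [map_add, mul_add, map_add, hx, hy,
        show LinearMap.mulRight k (x + y) = LinearMap.mulRight k x + LinearMap.mulRight k y by ext; simp [mul_add]]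
      rw [LinearMap.lTensor_add]; rfl
    | tmul r s =>
      induction t using TensorProduct.induction_on with
      | zero => simp
      | add x y hx hy => simp only [add_mul, map_add, hx, hy]
      | tmul x y =>
        rw [tens_tmul, Algebra.TensorProduct.tmul_mul_tmul]
        simp only [LinearMap.comp_apply, TensorProduct.map_tmul, a1, b1]
        generalize i x = v
        generalize j y = w
        induction v using TensorProduct.induction_on with
        | zero => simp
        | add x y hx hy => simp only [TensorProduct.add_tmul, map_add, hx, hy]
        | tmul v c =>
          induction w using TensorProduct.induction_on with
          | zero => simp
          | add x y hx hy => simp only [TensorProduct.tmul_add, map_add, hx, hy]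
          | tmul w d => simp
  · intro v c
    induction c using TensorProduct.induction_on with
    | zero => simp
    | add x y hx hy => rw [TensorProduct.tmul_add, map_add, hx, hy, map_add, mul_add]
    | tmul c d =>
      induction v using TensorProduct.induction_on with
      | zero => simp
      | add x y hx hy => simp only [TensorProduct.add_tmul, map_add, hx, hy, add_mul]
      | tmul v w =>
        rw [Algebra.TensorProduct.one_def, tens_tmul]
        simp only [LinearMap.comp_apply, LinearEquiv.coe_coe, TensorProduct.tensorTensorTensorComm_tmul, TensorProduct.map_tmul,
          Algebra.TensorProduct.tmul_mul_tmul]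
        rw [a2 v c, b2 w d]
  · intro t
    induction t using TensorProduct.induction_on with
    | zero => simp
    | add x y hx hy => simp only [add_mul, map_add, hx, hy]
    | tmul x y =>
      rw [Algebra.TensorProduct.one_def, tens_tmul, Algebra.TensorProduct.tmul_mul_tmul, ← a3, ← b3]
      simp only [LinearMap.comp_apply, TensorProduct.map_tmul]
      generalize i x = v
      generalize j y = w
      induction v using TensorProduct.induction_on with
      | zero => simp
      | add x y hx hy => simp only [TensorProduct.add_tmul, map_add, hx, hy]
      | tmul v c =>
        induction w using TensorProduct.induction_on with
        | zero => simp
        | add x y hx hy => simp only [TensorProduct.tmul_add, map_add, hx, hy]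
        | tmul w d => simp

theorem good_triv {S F : Type} [Ring S] [Ring F] [Algebra k S] [Algebra k F] (ι : S →ₙₐ[k] F)
    (α : F →ₗ[k] S) (h1 : ∀ t r, α (t * ι r) = α t * r) (h2 : ∀ t, t * ι 1 = ι (α t)) : Good ι := by
  refine ⟨k, inferInstance, inferInstance, (TensorProduct.lid k S).symm.toLinearMap.comp α,
    (ι : S →ₗ[k] F).comp (TensorProduct.lid k S).toLinearMap, ?_, ?_, ?_⟩
  · intro t r; simp [h1]
  · intro v c; simp [← map_mul]
  · intro t; simp [h2]

theorem good_mod {S F : Type} [Ring S] [Ring F] [Algebra k S] [Algebra k F] (ι : S →ₙₐ[k] F)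
    {M W : Type} [AddCommGroup M] [Module k M] [AddCommGroup W] [Module k W]
    (α : F →ₗ[k] S) (μ : F →ₗ[k] M) (jM : M →ₗ[k] F) (act : M →ₗ[k] S →ₗ[k] M)
    (h1 : ∀ t r, α (t * ι r) = α t * r) (h2 : ∀ t r, μ (t * ι r) = act (μ t) r)
    (h3 : ∀ m r, jM (act m r) = jM m * ι r) (h4 : ∀ t, t * ι 1 = ι (α t) + jM (μ t))
    (hact : ∀ m, act m 1 = m)
    (i' : M →ₗ[k] W ⊗[k] S) (p' : W →ₗ[k] M)
    (h5 : ∀ m r, i' (act m r) = LinearMap.lTensor W (LinearMap.mulRight k r) (i' m))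
    (h6 : ∀ m, TensorProduct.lift (act.comp p') (i' m) = m) : Good ι := by
  refine ⟨k × W, inferInstance, inferInstance,
    (TensorProduct.mk k (k × W) S (1, 0)).comp α + (LinearMap.rTensor S (LinearMap.inr k k W)).comp (i'.comp μ),
    (ι : S →ₗ[k] F).comp ((TensorProduct.lid k S).toLinearMap.comp (LinearMap.rTensor S (LinearMap.fst k k W))) +
      jM.comp ((TensorProduct.lift (act.comp p')).comp (LinearMap.rTensor S (LinearMap.snd k k W))), ?_, ?_, ?_⟩
  · intro t r
    simp only [LinearMap.add_apply, LinearMap.comp_apply, h1, h2, h5, map_add]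
    congr 1
    generalize i' (μ t) = w
    induction w using TensorProduct.induction_on with
    | zero => simp
    | add x y hx hy => simp only [map_add, hx, hy]
    | tmul w d => simp
  · rintro ⟨c, w⟩ s
    simp [add_mul, ← h3, ← map_mul, hact]
  · intro t
    have e1 : ∀ x : W ⊗[k] S, LinearMap.rTensor S (LinearMap.fst k k W) (LinearMap.rTensor S (LinearMap.inr k k W) x) = 0 := by
      intro x
      rw [← LinearMap.comp_apply, ← LinearMap.rTensor_comp, LinearMap.fst_comp_inr]; simp
    have e2 : ∀ x : W ⊗[k] S, LinearMap.rTensor S (LinearMap.snd k k W) (LinearMap.rTensor S (LinearMap.inr k k W) x) = x := by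
      intro x
      rw [← LinearMap.comp_apply, ← LinearMap.rTensor_comp, LinearMap.snd_comp_inr]; simp
    simp [h4, e1, e2, h6]
end Part4

section Part5
set_option linter.unusedSectionVars false
set_option linter.unusedSimpArgs false
variable (k A B M : Type) [Field k] [Ring A] [Ring B] [Algebra k A] [Algebra k B]
  [AddCommGroup M] [Module k M] [Module B M] [Module Aᵐᵒᵖ M]
  [SMulCommClass B Aᵐᵒᵖ M] [IsScalarTower k B M] [IsScalarTower k Aᵐᵒᵖ M]

theorem tri_left (p : A × B) (m : M) : p • m = p.2 • m := rfl
theorem tri_right (p : (A × B)ᵐᵒᵖ) (m : M) : p • m = op p.unop.1 • m := rfl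

def triA : A →ₙₐ[k] Tri A B M where
  toFun a := TrivSqZeroExt.inl (a, 0)
  map_smul' c a := by ext <;> simp
  map_zero' := by ext <;> simp
  map_add' a b := by ext <;> simp
  map_mul' a b := by ext <;> simp [tri_left, tri_right]

def triB : B →ₙₐ[k] Tri A B M where
  toFun a := TrivSqZeroExt.inl (0, a)
  map_smul' c a := by ext <;> simp
  map_zero' := by ext <;> simp
  map_add' a b := by ext <;> simp
  map_mul' a b := by ext <;> simp [tri_left, tri_right]

def nOp {S F : Type} [Ring S] [Ring F] [Algebra k S] [Algebra k F] (ι : S →ₙₐ[k] F) : Sᵐᵒᵖ →ₙₐ[k] Fᵐᵒᵖ where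
  toFun a := op (ι a.unop)
  map_smul' c a := by simp
  map_zero' := by simp
  map_add' a b := by simp
  map_mul' a b := by simp

theorem good_triB : Good (triB k A B M) := by
  refine good_triv _ ((LinearMap.snd k A B).comp (TrivSqZeroExt.fstHom k (A × B) M).toLinearMap) ?_ ?_
  · intro t r
    simp [triB]
  · intro t
    ext <;> simp [triB, tri_left, tri_right]

theorem good_triA' : Good (nOp k (triA k A B M)) := by
  refine good_triv _ ((opLinearEquiv k).toLinearMap ∘ₗ (LinearMap.fst k A B).comp (TrivSqZeroExt.fstHom k (A × B) M).toLinearMap ∘ₗ (opLinearEquiv k).symm.toLinearMap) ?_ ?_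
  · intro t r
    simp [triA, nOp]
  · intro t
    apply unop_injective
    ext <;> simp [triA, nOp, tri_left, tri_right]

def actD : B ⊗[k] Aᵐᵒᵖ →ₗ[k] M →ₗ[k] M :=
  LinearMap.mk₂ k (fun (d : B ⊗[k] Aᵐᵒᵖ) (m : M) => d • m) (by intros; rw [add_smul]) (by intros; rw [smul_assoc]) (by intros; rw [smul_add]) (by intros; rw [smul_comm])

theorem actD_apply (d : B ⊗[k] Aᵐᵒᵖ) (m : M) : actD k A B M d m = d • m := rfl

theorem exists_sec (hM : Module.Projective (B ⊗[k] Aᵐᵒᵖ) M) :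
    ∃ s : M →ₗ[k] (B ⊗[k] Aᵐᵒᵖ) ⊗[k] M, (∀ (d : B ⊗[k] Aᵐᵒᵖ) m, s (d • m) = LinearMap.rTensor M (LinearMap.mulLeft k d) (s m)) ∧
      ∀ m, TensorProduct.lift (actD k A B M) (s m) = m := by
  let act : (B ⊗[k] Aᵐᵒᵖ) ⊗[k] M →ₗ[B ⊗[k] Aᵐᵒᵖ] M :=
    { TensorProduct.lift (actD k A B M) with
      map_smul' := by
        intro d x
        induction x using TensorProduct.induction_on with
        | zero => simp
        | add x y hx hy => simp only [smul_add]; simp_all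
        | tmul x y => simp [TensorProduct.smul_tmul', actD_apply, mul_smul] }
  obtain ⟨s, hs⟩ := Module.projective_lifting_property act LinearMap.id (fun m => ⟨1 ⊗ₜ m, by simp [act, actD_apply]⟩)
  refine ⟨s.restrictScalars k, ?_, ?_⟩
  · intro d m
    simp only [LinearMap.restrictScalars_apply, map_smul]
    generalize s m = x
    induction x using TensorProduct.induction_on with
    | zero => simp
    | add x y hx hy => simp only [smul_add, map_add, hx, hy]
    | tmul x y => simp [TensorProduct.smul_tmul']
  · intro m
    exact LinearMap.congr_fun hs m


theorem tmul_smul_M (b : B) (a : Aᵐᵒᵖ) (m : M) : (b ⊗ₜ[k] a) • m = b • a • m := rfl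

def actA : M →ₗ[k] A →ₗ[k] M :=
  LinearMap.mk₂ k (fun m a => op a • m) (by intros; rw [smul_add]) (by intros; rw [smul_comm])
    (by intros; rw [MulOpposite.op_add, add_smul]) (by intros; rw [MulOpposite.op_smul, smul_assoc])

def actB : M →ₗ[k] Bᵐᵒᵖ →ₗ[k] M :=
  LinearMap.mk₂ k (fun m b => unop b • m) (by intros; rw [smul_add]) (by intros; rw [smul_comm])
    (by intros; rw [MulOpposite.unop_add, add_smul]) (by intros; rw [MulOpposite.unop_smul, smul_assoc])

def lB : B ⊗[k] M →ₗ[k] M := TensorProduct.lift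
  (LinearMap.mk₂ k (fun b m => b • m) (by intros; rw [add_smul]) (by intros; rw [smul_assoc])
    (by intros; rw [smul_add]) (by intros; rw [smul_comm]))

def lA : Aᵐᵒᵖ ⊗[k] M →ₗ[k] M := TensorProduct.lift
  (LinearMap.mk₂ k (fun b m => b • m) (by intros; rw [add_smul]) (by intros; rw [smul_assoc])
    (by intros; rw [smul_add]) (by intros; rw [smul_comm]))

def sigA : (B ⊗[k] Aᵐᵒᵖ) ⊗[k] M →ₗ[k] (B ⊗[k] M) ⊗[k] A :=
  (LinearMap.lTensor _ (opLinearEquiv k (M := A)).symm.toLinearMap).comp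
    (TensorProduct.rightComm k B Aᵐᵒᵖ M).toLinearMap

def sigB : (B ⊗[k] Aᵐᵒᵖ) ⊗[k] M →ₗ[k] (Aᵐᵒᵖ ⊗[k] M) ⊗[k] Bᵐᵒᵖ :=
  (LinearMap.lTensor _ (opLinearEquiv k (M := B)).toLinearMap).comp
    ((TensorProduct.comm k B (Aᵐᵒᵖ ⊗[k] M)).toLinearMap.comp (TensorProduct.assoc k B Aᵐᵒᵖ M).toLinearMap)

theorem sigA_tmul (b : B) (a : Aᵐᵒᵖ) (m : M) : sigA k A B M ((b ⊗ₜ a) ⊗ₜ m) = (b ⊗ₜ m) ⊗ₜ unop a := rfl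
theorem sigB_tmul (b : B) (a : Aᵐᵒᵖ) (m : M) : sigB k A B M ((b ⊗ₜ a) ⊗ₜ m) = (a ⊗ₜ m) ⊗ₜ op b := rfl

theorem sigA_mul (r : A) (x : (B ⊗[k] Aᵐᵒᵖ) ⊗[k] M) :
    sigA k A B M (LinearMap.rTensor M (LinearMap.mulLeft k (1 ⊗ₜ op r)) x) =
      LinearMap.lTensor _ (LinearMap.mulRight k r) (sigA k A B M x) := by
  induction x using TensorProduct.induction_on with
  | zero => simp
  | add x y hx hy => simp only [map_add, hx, hy]
  | tmul d m =>
    induction d using TensorProduct.induction_on with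
    | zero => simp
    | add x y hx hy => simp only [map_add, TensorProduct.add_tmul, hx, hy]
    | tmul b a => simp [sigA_tmul]

theorem sigB_mul (r : Bᵐᵒᵖ) (x : (B ⊗[k] Aᵐᵒᵖ) ⊗[k] M) :
    sigB k A B M (LinearMap.rTensor M (LinearMap.mulLeft k (unop r ⊗ₜ 1)) x) =
      LinearMap.lTensor _ (LinearMap.mulRight k r) (sigB k A B M x) := by
  induction x using TensorProduct.induction_on with
  | zero => simp
  | add x y hx hy => simp only [map_add, hx, hy]
  | tmul d m =>
    induction d using TensorProduct.induction_on with
    | zero => simp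
    | add x y hx hy => simp only [map_add, TensorProduct.add_tmul, hx, hy]
    | tmul b a => simp [sigB_tmul]

theorem sigA_act (x : (B ⊗[k] Aᵐᵒᵖ) ⊗[k] M) :
    TensorProduct.lift ((actA k A M).comp (lB k B M)) (sigA k A B M x) = TensorProduct.lift (actD k A B M) x := by
  induction x using TensorProduct.induction_on with
  | zero => simp
  | add x y hx hy => simp only [map_add, hx, hy]
  | tmul d m =>
    induction d using TensorProduct.induction_on with
    | zero => simp
    | add x y hx hy => simp only [map_add, TensorProduct.add_tmul, hx, hy]
    | tmul b a => simp [sigA_tmul, actD_apply, tmul_smul_M, lB, actA, smul_comm]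

theorem sigB_act (x : (B ⊗[k] Aᵐᵒᵖ) ⊗[k] M) :
    TensorProduct.lift ((actB k B M).comp (lA k A M)) (sigB k A B M x) = TensorProduct.lift (actD k A B M) x := by
  induction x using TensorProduct.induction_on with
  | zero => simp
  | add x y hx hy => simp only [map_add, hx, hy]
  | tmul d m =>
    induction d using TensorProduct.induction_on with
    | zero => simp
    | add x y hx hy => simp only [map_add, TensorProduct.add_tmul, hx, hy]
    | tmul b a => simp [sigB_tmul, actD_apply, tmul_smul_M, lA, actB]

def triInr : M →ₗ[k] Tri A B M where
  toFun m := TrivSqZeroExt.inr m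
  map_add' := by intros; ext <;> simp
  map_smul' := by intros; ext <;> simp

def triSnd : Tri A B M →ₗ[k] M where
  toFun m := TrivSqZeroExt.snd m
  map_add' := by intros; simp
  map_smul' := by intros; simp

theorem triSnd_apply (z : Tri A B M) : triSnd k A B M z = TrivSqZeroExt.snd z := rfl

theorem good_triA (hM : Module.Projective (B ⊗[k] Aᵐᵒᵖ) M) : Good (triA k A B M) := by
  obtain ⟨s, hs1, hs2⟩ := exists_sec k A B M hM
  refine good_mod _ ((LinearMap.fst k A B).comp (TrivSqZeroExt.fstHom k (A × B) M).toLinearMap)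
    (triSnd k A B M) (triInr k A B M) (actA k A M) ?_ ?_ ?_ ?_ ?_ ((sigA k A B M).comp s) (lB k B M) ?_ ?_
  · intro t r; simp [triA]
  · intro t r; simp [triA, triSnd_apply, actA, tri_left, tri_right]
  · intro t r; ext <;> simp [triA, triInr, actA, tri_left, tri_right]
  · intro t; ext <;> simp [triA, triInr, triSnd_apply, tri_left, tri_right]
  · intro m; simp [actA]
  · intro m r
    rw [LinearMap.comp_apply, LinearMap.comp_apply, ← sigA_mul, ← hs1, tmul_smul_M, one_smul]; rfl
  · intro m
    rw [LinearMap.comp_apply, sigA_act, hs2]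

theorem good_triB' (hM : Module.Projective (B ⊗[k] Aᵐᵒᵖ) M) : Good (nOp k (triB k A B M)) := by
  obtain ⟨s, hs1, hs2⟩ := exists_sec k A B M hM
  refine good_mod _ ((opLinearEquiv k).toLinearMap ∘ₗ (LinearMap.snd k A B).comp (TrivSqZeroExt.fstHom k (A × B) M).toLinearMap ∘ₗ (opLinearEquiv k).symm.toLinearMap)
    ((triSnd k A B M).comp (opLinearEquiv k).symm.toLinearMap) ((opLinearEquiv k).toLinearMap.comp (triInr k A B M)) (actB k B M) ?_ ?_ ?_ ?_ ?_ ((sigB k A B M).comp s) (lA k A M) ?_ ?_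
  · intro t r; simp [triB, nOp]
  · intro t r; simp [triB, nOp, triSnd_apply, actB, tri_left, tri_right]
  · intro t r; apply unop_injective; ext <;> simp [nOp, triB, triInr, actB, tri_left, tri_right]
  · intro t; apply unop_injective; ext <;> simp [nOp, triB, triInr, triSnd_apply, tri_left, tri_right]
  · intro m; simp [actB]
  · intro m r
    rw [LinearMap.comp_apply, LinearMap.comp_apply, ← sigB_mul, ← hs1, tmul_smul_M, one_smul]; rfl
  · intro m
    rw [LinearMap.comp_apply, sigB_act, hs2]


theorem proj_abs {k E D M Z : Type} [Field k] [Ring E] [Algebra k E] [Ring D] [Algebra k D] [AddCommGroup M]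
    [Module k M] [Module D M] [IsScalarTower k D M] [AddCommGroup Z] [Module E Z]
    (π : E →ₗ[k] D) (κ : D →ₗ[k] E) (hκ : ∀ x d, κ (π x * d) = x * κ d) (hπ : ∀ d, π (κ d) = d)
    (i : M ≃+ Z) (hi : ∀ x m, x • i m = i (π x • m))
    (act : D →ₗ[k] M →ₗ[k] M) (hact : ∀ d m, act d m = d • m)
    (s : M →ₗ[k] D ⊗[k] M) (hs1 : ∀ d m, s (d • m) = LinearMap.rTensor M (LinearMap.mulLeft k d) (s m))
    (hs2 : ∀ m, TensorProduct.lift act (s m) = m) : Module.Projective E Z := by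
  let _ : Module k Z := Module.compHom Z (algebraMap k E)
  have : IsScalarTower k E Z := ⟨fun c x z => by
    rw [Algebra.smul_def, mul_smul]; rfl⟩
  have hic : ∀ (c : k) m, i (c • m) = c • i m := by
    intro c m
    show _ = algebraMap k E c • i m
    have h1 : π (κ 1) = 1 := hπ 1
    have : i m = κ 1 • i m := by rw [hi, h1, one_smul]
    rw [this, ← mul_smul, ← Algebra.smul_def, hi, LinearMap.map_smul π, h1, smul_assoc, one_smul]
  let q : E ⊗[k] M →ₗ[E] Z :=
    { TensorProduct.lift (LinearMap.mk₂ k (fun (x : E) (m : M) => x • i m)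
        (by intros; rw [add_smul]) (by intros; rw [smul_assoc])
        (by intros; rw [map_add, smul_add])
        (by
          intro c x m
          rw [hi, hi, ← hic]
          congr 1
          rw [← hact, ← hact, map_smul])) with
      map_smul' := by
        intro d x
        induction x using TensorProduct.induction_on with
        | zero => simp
        | add x y hx hy => simp only [smul_add]; simp_all
        | tmul x y => simp [TensorProduct.smul_tmul', mul_smul] }
  have hq : ∀ x m, q (x ⊗ₜ m) = x • i m := fun _ _ => rfl
  let j : Z →ₗ[E] E ⊗[k] M :=
    { toFun := fun z => LinearMap.rTensor M κ (s (i.symm z))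
      map_add' := by intro x y; simp
      map_smul' := by
        intro x z
        obtain ⟨m, rfl⟩ := i.surjective z
        simp only [RingHom.id_apply]
        rw [hi, i.symm_apply_apply, i.symm_apply_apply, hs1]
        generalize s m = w
        induction w using TensorProduct.induction_on with
        | zero => simp
        | add x y hx hy => simp only [map_add, smul_add, hx, hy]
        | tmul d m => simp [hκ, TensorProduct.smul_tmul'] }
  refine Module.Projective.of_split j q ?_
  ext1 z
  have h : ∀ w : D ⊗[k] M, q (LinearMap.rTensor M κ w) = i (TensorProduct.lift act w) := by
    intro w
    induction w using TensorProduct.induction_on with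
    | zero => simp
    | add x y hx hy => simp only [map_add, hx, hy]
    | tmul d m =>
      rw [LinearMap.rTensor_tmul, hq, hi, hπ, TensorProduct.lift.tmul, hact]
  show q (LinearMap.rTensor M κ (s (i.symm z))) = z
  rw [h, hs2, i.apply_symm_apply]

abbrev TE : Type := Tri A B M ⊗[k] (Tri A B M)ᵐᵒᵖ

instance teMod : Module (TE k A B M) (Tri A B M) := envModule k (Tri A B M)
instance teSMul : SMul (TE k A B M) (Tri A B M) := (teMod k A B M).toSMul

theorem te_zero (z : Tri A B M) : (0 : TE k A B M) • z = 0 := zero_smul (TE k A B M) z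

theorem env_smul {R : Type} [Ring R] [Algebra k R] (x : R) (y : Rᵐᵒᵖ) (z : R) :
    (x ⊗ₜ[k] y) • z = x * (z * unop y) := rfl

theorem triA_apply (a : A) : triA k A B M a = TrivSqZeroExt.inl (a, 0) := rfl
theorem triB_apply (a : B) : triB k A B M a = TrivSqZeroExt.inl (0, a) := rfl
theorem nOp_apply {S F : Type} [Ring S] [Ring F] [Algebra k S] [Algebra k F] (ι : S →ₙₐ[k] F) (a : Sᵐᵒᵖ) :
    nOp k ι a = op (ι a.unop) := rfl

def IA : Submodule (TE k A B M) (Tri A B M) where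
  carrier := {z | z.fst.2 = 0}
  add_mem' {a b} ha hb := by
    simp only [Set.mem_ofPred_eq] at *; simp [ha, hb]
  zero_mem' := by simp
  smul_mem' c z hz := by
    simp only [Set.mem_ofPred_eq] at *
    induction c using TensorProduct.induction_on with
    | zero => simp [te_zero]
    | add x y hx hy => simp [add_smul, hx, hy]
    | tmul x y => simp [env_smul, hz]

def IB : Submodule (TE k A B M) (Tri A B M) where
  carrier := {z | z.fst.1 = 0}
  add_mem' {a b} ha hb := by
    simp only [Set.mem_ofPred_eq] at *; simp [ha, hb]
  zero_mem' := by simp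
  smul_mem' c z hz := by
    simp only [Set.mem_ofPred_eq] at *
    induction c using TensorProduct.induction_on with
    | zero => simp [te_zero]
    | add x y hx hy => simp [add_smul, hx, hy]
    | tmul x y => simp [env_smul, hz]

theorem mem_IA (z : Tri A B M) : z ∈ IA k A B M ↔ z.fst.2 = 0 := Iff.rfl
theorem mem_IB (z : Tri A B M) : z ∈ IB k A B M ↔ z.fst.1 = 0 := Iff.rfl

def IM : Submodule (TE k A B M) (Tri A B M) := IA k A B M ⊓ IB k A B M

theorem mem_IM (z : Tri A B M) : z ∈ IM k A B M ↔ z = TrivSqZeroExt.inr z.snd := by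
  rw [IM, Submodule.mem_inf, mem_IA, mem_IB]
  constructor
  · rintro ⟨h1, h2⟩
    ext <;> simp [h1, h2]
  · intro h
    rw [h]; simp

def piD : TE k A B M →ₗ[k] B ⊗[k] Aᵐᵒᵖ :=
  TensorProduct.map ((LinearMap.snd k A B).comp (TrivSqZeroExt.fstHom k (A × B) M).toLinearMap)
    ((opLinearEquiv k).toLinearMap ∘ₗ (LinearMap.fst k A B).comp (TrivSqZeroExt.fstHom k (A × B) M).toLinearMap ∘ₗ (opLinearEquiv k).symm.toLinearMap)

theorem piD_tmul (x : Tri A B M) (y : (Tri A B M)ᵐᵒᵖ) : piD k A B M (x ⊗ₜ y) = x.fst.2 ⊗ₜ op y.unop.fst.1 := rfl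

def kap : B ⊗[k] Aᵐᵒᵖ →ₗ[k] TE k A B M :=
  TensorProduct.map (triB k A B M : B →ₗ[k] Tri A B M) (nOp k (triA k A B M) : Aᵐᵒᵖ →ₗ[k] (Tri A B M)ᵐᵒᵖ)

theorem kap_tmul (b : B) (a : Aᵐᵒᵖ) : kap k A B M (b ⊗ₜ a) = triB k A B M b ⊗ₜ op (triA k A B M a.unop) := rfl

theorem kap_mul (x : TE k A B M) (d : B ⊗[k] Aᵐᵒᵖ) : kap k A B M (piD k A B M x * d) = x * kap k A B M d := by
  induction x using TensorProduct.induction_on with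
  | zero => simp
  | add x y hx hy => simp only [map_add, add_mul, hx, hy]
  | tmul x y =>
    induction d using TensorProduct.induction_on with
    | zero => simp
    | add x y hx hy => simp only [map_add, mul_add, hx, hy]
    | tmul b a =>
      rw [piD_tmul, kap_tmul, Algebra.TensorProduct.tmul_mul_tmul, Algebra.TensorProduct.tmul_mul_tmul, kap_tmul]
      congr 1
      · ext <;> simp [triB_apply, tri_left, tri_right]
      · apply unop_injective
        ext <;> simp [triA_apply, tri_left, tri_right]

theorem pi_kap (d : B ⊗[k] Aᵐᵒᵖ) : piD k A B M (kap k A B M d) = d := by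
  induction d using TensorProduct.induction_on with
  | zero => simp
  | add x y hx hy => simp only [map_add, hx, hy]
  | tmul b a => simp [kap_tmul, piD_tmul, triA_apply, triB_apply]

theorem smul_inr (x : TE k A B M) (m : M) :
    x • (TrivSqZeroExt.inr m : Tri A B M) = TrivSqZeroExt.inr (piD k A B M x • m) := by
  induction x using TensorProduct.induction_on with
  | zero => rw [te_zero, map_zero, show (0 : B ⊗[k] Aᵐᵒᵖ) • m = 0 from zero_smul (B ⊗[k] Aᵐᵒᵖ) m]; simp
  | add x y hx hy => simp only [map_add, add_smul, hx, hy, TrivSqZeroExt.inr_add]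
  | tmul x y =>
    rw [env_smul, piD_tmul, tmul_smul_M]
    ext <;> simp [tri_left, tri_right]

instance imMod : Module (TE k A B M) (IM k A B M) := Submodule.module _
instance imSMul : SMul (TE k A B M) (IM k A B M) := (imMod k A B M).toSMul

def imEquiv : M ≃+ IM k A B M where
  toFun m := ⟨TrivSqZeroExt.inr m, by rw [mem_IM]; simp⟩
  invFun z := z.1.snd
  left_inv m := by simp
  right_inv z := Subtype.ext ((mem_IM k A B M z.1).1 z.2).symm
  map_add' x y := Subtype.ext (by simp)

theorem IM_proj (hM : Module.Projective (B ⊗[k] Aᵐᵒᵖ) M) : Module.Projective (TE k A B M) (IM k A B M) := by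
  obtain ⟨s, hs1, hs2⟩ := exists_sec k A B M hM
  refine proj_abs (Z := IM k A B M) (piD k A B M) (kap k A B M) (kap_mul k A B M) (pi_kap k A B M) (imEquiv k A B M) ?_ (actD k A B M) ?_ s ?_ hs2
  · intro x m
    exact Subtype.ext (smul_inr k A B M x m)
  · intro d m; rfl
  · exact hs1


section Abs
variable {k R L : Type} [Field k] [Ring R] [Ring L] [Algebra k R] [Algebra k L] (ι : R →ₙₐ[k] L)

theorem eps_tmul (x y : R) : tens ι (nOp k ι) (x ⊗ₜ op y) = ι x ⊗ₜ op (ι y) := rfl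

theorem eps_one : tens ι (nOp k ι) 1 = ι 1 ⊗ₜ op (ι 1) := rfl

theorem eps_smul_ι (d : R ⊗[k] Rᵐᵒᵖ) (r : R) : tens ι (nOp k ι) d • ι r = ι (d • r) := by
  induction d using TensorProduct.induction_on with
  | zero =>
    rw [map_zero, show (0 : R ⊗[k] Rᵐᵒᵖ) • r = 0 from zero_smul (R ⊗[k] Rᵐᵒᵖ) r,
      show (0 : L ⊗[k] Lᵐᵒᵖ) • ι r = 0 from zero_smul (L ⊗[k] Lᵐᵒᵖ) (ι r), map_zero]
  | add x y hx hy => rw [map_add, add_smul, hx, hy, add_smul, map_add]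
  | tmul x y =>
    show ι x * (ι r * ι y.unop) = ι (x * (r * y.unop))
    simp

def uI (I : Submodule (L ⊗[k] Lᵐᵒᵖ) L) (hI : ∀ r, ι r ∈ I) : R →ₗ[R ⊗[k] Rᵐᵒᵖ] cor (tens ι (nOp k ι)) I where
  toFun r := ⟨⟨ι r, hI r⟩, by
    rw [mem_cor]
    apply Subtype.ext
    show tens ι (nOp k ι) 1 • ι r = ι r
    rw [eps_smul_ι, one_smul]⟩
  map_add' x y := by
    apply Subtype.ext; apply Subtype.ext
    exact map_add ι x y
  map_smul' d x := by
    apply Subtype.ext; apply Subtype.ext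
    rw [RingHom.id_apply, cor_smul_val]
    exact (eps_smul_ι ι d x).symm

theorem uI_val (I : Submodule (L ⊗[k] Lᵐᵒᵖ) L) (hI : ∀ r, ι r ∈ I) (r : R) : (uI ι I hI r).1.1 = ι r := rfl

def uL : R →ₗ[R ⊗[k] Rᵐᵒᵖ] cor (tens ι (nOp k ι)) L where
  toFun r := ⟨ι r, by
    rw [mem_cor, eps_smul_ι, one_smul]⟩
  map_add' x y := by
    apply Subtype.ext
    exact map_add ι x y
  map_smul' d x := by
    apply Subtype.ext
    rw [RingHom.id_apply, cor_smul_val]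
    exact (eps_smul_ι ι d x).symm

theorem uL_bij (hι : Function.Injective ι) (h : ∀ z, ∃ r, ι 1 * (z * ι 1) = ι r) : Function.Bijective (uL ι) := by
  constructor
  · intro x y hxy
    exact hι (congrArg (fun z => z.1) hxy)
  · intro z
    obtain ⟨r, hr⟩ := h z.1
    refine ⟨r, Subtype.ext ?_⟩
    have := z.2
    rw [mem_cor] at this
    exact hr.symm.trans this

variable (Y : Type) [AddCommGroup Y] [Module (L ⊗[k] Lᵐᵒᵖ) Y] (g : R →ₗ[R ⊗[k] Rᵐᵒᵖ] cor (tens ι (nOp k ι)) Y)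

theorem g_left (x : R) : (ι x ⊗ₜ[k] (1 : Lᵐᵒᵖ)) • (g 1).1 = (g x).1 := by
  have h := (g 1).2
  rw [mem_cor, eps_one] at h
  rw [← h, ← mul_smul]
  have h2 : g x = (x ⊗ₜ[k] op 1 : R ⊗[k] Rᵐᵒᵖ) • g 1 := by
    rw [← map_smul]; congr 1
    show x = x * (1 * 1)
    simp
  rw [h2, cor_smul_val, eps_tmul, Algebra.TensorProduct.tmul_mul_tmul, ← map_mul, mul_one, one_mul]

theorem g_right (x : R) : ((1 : L) ⊗ₜ[k] op (ι x)) • (g 1).1 = (g x).1 := by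
  have h := (g 1).2
  rw [mem_cor, eps_one] at h
  rw [← h, ← mul_smul]
  have h2 : g x = (1 ⊗ₜ[k] op x : R ⊗[k] Rᵐᵒᵖ) • g 1 := by
    rw [← map_smul]; congr 1
    show x = 1 * (1 * x)
    simp
  rw [h2, cor_smul_val, eps_tmul, Algebra.TensorProduct.tmul_mul_tmul, ← op_mul, ← map_mul, one_mul, one_mul]

theorem univ_left (ρ : L → R) (hρ : ∀ w, ι 1 * w = ι (ρ w)) (I : Submodule (L ⊗[k] Lᵐᵒᵖ) L)
    (hI : ∀ r, ι r ∈ I) (hI' : ∀ z ∈ I, z * ι 1 = z) :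
    ∃! f : I →ₗ[L ⊗[k] Lᵐᵒᵖ] Y, ∀ x, f (uI ι I hI x).1 = (g x).1 := by
  have h1 : ((1 : L) ⊗ₜ[k] op (ι 1)) • (g 1).1 = (g 1).1 := g_right ι Y g 1
  have key : ∀ w m : L, (w ⊗ₜ[k] op m) • (g 1).1 = ((w * (ι 1 * m)) ⊗ₜ[k] (1 : Lᵐᵒᵖ)) • (g 1).1 := by
    intro w m
    have e1 : (w ⊗ₜ[k] op m) • (g 1).1 = (w ⊗ₜ[k] (1 : Lᵐᵒᵖ)) • ((1 : L) ⊗ₜ[k] op (ι (ρ m))) • (g 1).1 := by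
      conv_lhs => rw [← h1]
      rw [← mul_smul, ← mul_smul, ← hρ]
      simp
    rw [e1, g_right, ← g_left, ← mul_smul, hρ]
    simp
  refine ⟨{ toFun := fun z => (z.1 ⊗ₜ[k] (1 : Lᵐᵒᵖ)) • (g 1).1, map_add' := ?_, map_smul' := ?_ }, ?_, ?_⟩
  · intro x y
    rw [← add_smul, ← TensorProduct.add_tmul]; rfl
  · intro c z
    rw [RingHom.id_apply]
    show ((c • z.1) ⊗ₜ[k] (1 : Lᵐᵒᵖ)) • (g 1).1 = _
    induction c using TensorProduct.induction_on with
    | zero =>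
      rw [show (0 : L ⊗[k] Lᵐᵒᵖ) • z.1 = 0 from zero_smul (L ⊗[k] Lᵐᵒᵖ) z.1, TensorProduct.zero_tmul]
      exact (zero_smul (L ⊗[k] Lᵐᵒᵖ) (_ : Y)).trans (zero_smul (L ⊗[k] Lᵐᵒᵖ) (_ : Y)).symm
    | add x y hx hy => rw [add_smul, TensorProduct.add_tmul, add_smul, hx, hy, add_smul]
    | tmul x y =>
      rw [← mul_smul, Algebra.TensorProduct.tmul_mul_tmul, mul_one, ← op_unop y, key, env_smul, unop_op]
      congr 2
      conv_lhs => rw [← hI' z.1 z.2]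
      simp only [mul_assoc]
  · intro x
    exact g_left ι Y g x
  · intro f hf
    ext z
    have h2 : z = (z.1 ⊗ₜ[k] (1 : Lᵐᵒᵖ)) • (uI ι I hI 1).1 := by
      apply Subtype.ext
      show z.1 = z.1 * (ι 1 * 1)
      rw [mul_one, hI' z.1 z.2]
    conv_lhs => rw [h2, map_smul, hf]
    rfl

theorem univ_right (ρ : L → R) (hρ : ∀ w, w * ι 1 = ι (ρ w)) (I : Submodule (L ⊗[k] Lᵐᵒᵖ) L)
    (hI : ∀ r, ι r ∈ I) (hI' : ∀ z ∈ I, ι 1 * z = z) :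
    ∃! f : I →ₗ[L ⊗[k] Lᵐᵒᵖ] Y, ∀ x, f (uI ι I hI x).1 = (g x).1 := by
  have h1 : (ι 1 ⊗ₜ[k] (1 : Lᵐᵒᵖ)) • (g 1).1 = (g 1).1 := g_left ι Y g 1
  have key : ∀ w m : L, (w ⊗ₜ[k] op m) • (g 1).1 = ((1 : L) ⊗ₜ[k] op (w * ι 1 * m)) • (g 1).1 := by
    intro w m
    have e1 : (w ⊗ₜ[k] op m) • (g 1).1 = ((1 : L) ⊗ₜ[k] op m) • (ι (ρ w) ⊗ₜ[k] (1 : Lᵐᵒᵖ)) • (g 1).1 := by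
      conv_lhs => rw [← h1]
      rw [← mul_smul, ← mul_smul, ← hρ]
      simp
    rw [e1, g_left, ← g_right, ← mul_smul, hρ]
    simp
  refine ⟨{ toFun := fun z => ((1 : L) ⊗ₜ[k] op z.1) • (g 1).1, map_add' := ?_, map_smul' := ?_ }, ?_, ?_⟩
  · intro x y
    rw [← add_smul, ← TensorProduct.tmul_add]; rfl
  · intro c z
    rw [RingHom.id_apply]
    show ((1 : L) ⊗ₜ[k] op (c • z.1)) • (g 1).1 = _
    induction c using TensorProduct.induction_on with
    | zero =>
      rw [show (0 : L ⊗[k] Lᵐᵒᵖ) • z.1 = 0 from zero_smul (L ⊗[k] Lᵐᵒᵖ) z.1, MulOpposite.op_zero, TensorProduct.tmul_zero]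
      exact (zero_smul (L ⊗[k] Lᵐᵒᵖ) (_ : Y)).trans (zero_smul (L ⊗[k] Lᵐᵒᵖ) (_ : Y)).symm
    | add x y hx hy => rw [add_smul, MulOpposite.op_add, TensorProduct.tmul_add, add_smul, hx, hy, add_smul]
    | tmul x y =>
      rw [← mul_smul, Algebra.TensorProduct.tmul_mul_tmul, mul_one, ← op_unop y, ← op_mul, key x, env_smul, unop_op]
      have h3 : x * (z.1 * unop y) = x * ι 1 * (z.1 * unop y) := by
        conv_lhs => rw [← hI' z.1 z.2]
        simp only [mul_assoc]
      rw [h3]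
  · intro x
    exact g_right ι Y g x
  · intro f hf
    ext z
    have h2 : z = ((1 : L) ⊗ₜ[k] op z.1) • (uI ι I hI 1).1 := by
      apply Subtype.ext
      show z.1 = 1 * (ι 1 * z.1)
      rw [one_mul, hI' z.1 z.2]
    conv_lhs => rw [h2, map_smul, hf]
    rfl

end Abs


theorem ses_iso {k E Z : Type} [Field k] [Ring E] [Algebra k E] [AddCommGroup Z] [Module E Z]
    (I J : Submodule E Z) (h : ∀ z, ∃ x ∈ I, ∃ y ∈ J, x + y = z)
    (hp : Module.Projective E (I ⊓ J : Submodule E Z)) (Y : ModuleCat.{0} E) (n : ℕ) :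
    Nonempty (Abelian.Ext.{0} (ModuleCat.of E Z) Y (n+2) ≃ₗ[k]
      (Abelian.Ext.{0} (ModuleCat.of E I) Y (n+2) × Abelian.Ext.{0} (ModuleCat.of E J) Y (n+2))) := by
  let f : (I ⊓ J : Submodule E Z) →ₗ[E] I × J :=
    LinearMap.prod (Submodule.inclusion inf_le_left) (-(Submodule.inclusion inf_le_right))
  let g : I × J →ₗ[E] Z := LinearMap.coprod I.subtype J.subtype
  have hfg : g.comp f = 0 := by
    ext z; simp [f, g]
  let S : ShortComplex (ModuleCat.{0} E) :=
    ShortComplex.mk (ModuleCat.ofHom f) (ModuleCat.ofHom g) (by rw [← ModuleCat.ofHom_comp, hfg]; rfl)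
  have hS : S.ShortExact := by
    have hm : Mono S.f := by
      rw [ModuleCat.mono_iff_injective]
      intro x y hxy
      have := congrArg (fun z : I × J => z.1.1) hxy
      exact Subtype.ext this
    have he : Epi S.g := by
      rw [ModuleCat.epi_iff_surjective]
      intro z
      obtain ⟨x, hx, y, hy, e⟩ := h z
      exact ⟨(⟨x, hx⟩, ⟨y, hy⟩), e⟩
    refine { exact := ?_, mono_f := hm, epi_g := he }
    rw [ShortComplex.moduleCat_exact_iff]
    rintro ⟨x, y⟩ hxy
    have hxy' : x.1 + y.1 = 0 := hxy
    have e : x.1 = - y.1 := eq_neg_of_add_eq_zero_left hxy'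
    refine ⟨⟨x.1, x.2, by rw [e]; exact J.neg_mem y.2⟩, ?_⟩
    refine Prod.ext (Subtype.ext rfl) (Subtype.ext ?_)
    show -x.1 = y.1
    rw [e, neg_neg]
  have : Projective S.X₁ := (IsProjective.iff_projective _ |>.1 hp)
  obtain ⟨e1⟩ := contra_iso (k := k) hS Y n
  obtain ⟨e2⟩ := prod_iso (k := k) (X := ModuleCat.of E (I × J)) (P := ModuleCat.of E I) (Q := ModuleCat.of E J)
    (ModuleCat.ofHom (LinearMap.inl E I J)) (ModuleCat.ofHom (LinearMap.inr E I J))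
    (ModuleCat.ofHom (LinearMap.fst E I J)) (ModuleCat.ofHom (LinearMap.snd E I J))
    (by rw [← ModuleCat.ofHom_comp, LinearMap.fst_comp_inl]; rfl)
    (by rw [← ModuleCat.ofHom_comp, LinearMap.snd_comp_inr]; rfl)
    (by rw [← ModuleCat.ofHom_comp, LinearMap.snd_comp_inl]; rfl)
    (by rw [← ModuleCat.ofHom_comp, LinearMap.fst_comp_inr]; rfl)
    (by ext ⟨x, y⟩ <;> simp) Y (n+2)
  exact ⟨e1.trans e2⟩

theorem final_aux (hM : Module.Projective (B ⊗[k] Aᵐᵒᵖ) M) (n : ℕ) :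
    Nonempty (HHt k (Tri A B M) (n+2) ≃ₗ[k] (HHt k A (n+2) × HHt k B (n+2))) := by
  obtain ⟨e0⟩ := old_new (k := k) (ModuleCat.of (TE k A B M) (Tri A B M)) (ModuleCat.of (TE k A B M) (Tri A B M)) (n+1)
  obtain ⟨eA⟩ := old_new (k := k) (ModuleCat.of (A ⊗[k] Aᵐᵒᵖ) A) (ModuleCat.of (A ⊗[k] Aᵐᵒᵖ) A) (n+1)
  obtain ⟨eB⟩ := old_new (k := k) (ModuleCat.of (B ⊗[k] Bᵐᵒᵖ) B) (ModuleCat.of (B ⊗[k] Bᵐᵒᵖ) B) (n+1)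
  obtain ⟨e1⟩ := ses_iso (k := k) (IA k A B M) (IB k A B M) (by
    intro z
    refine ⟨TrivSqZeroExt.inl (z.fst.1, 0), by simp [mem_IA], z - TrivSqZeroExt.inl (z.fst.1, 0), by simp [mem_IB], by simp⟩)
    (IM_proj k A B M hM) (ModuleCat.of (TE k A B M) (Tri A B M)) n
  have hA : ∀ r, triA k A B M r ∈ IA k A B M := by
    intro r; simp [mem_IA, triA_apply]
  have hB : ∀ r, triB k A B M r ∈ IB k A B M := by
    intro r; simp [mem_IB, triB_apply]
  obtain ⟨fA⟩ := corner_ext (tens (triA k A B M) (nOp k (triA k A B M)))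
    (good_tens _ _ (good_triA k A B M hM) (good_triA' k A B M)) (IA k A B M) A
    (uI (triA k A B M) (IA k A B M) hA)
    (fun Y _ _ g => univ_left (triA k A B M) Y g (fun z => z.fst.1)
      (by intro w; ext <;> simp [triA_apply, tri_left, tri_right]) (IA k A B M) hA
      (by
        intro z hz
        rw [mem_IA] at hz
        ext <;> simp [triA_apply, tri_left, tri_right, hz]))
    (Tri A B M) A (LinearEquiv.ofBijective (uL (triA k A B M)) (uL_bij _
      (by
        intro x y hxy
        exact congrArg (fun z : Tri A B M => z.fst.1) hxy)
      (by
        intro z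
        refine ⟨z.fst.1, ?_⟩
        ext <;> simp [triA_apply, tri_left, tri_right]))).symm (n+1)
  obtain ⟨fB⟩ := corner_ext (tens (triB k A B M) (nOp k (triB k A B M)))
    (good_tens _ _ (good_triB k A B M) (good_triB' k A B M hM)) (IB k A B M) B
    (uI (triB k A B M) (IB k A B M) hB)
    (fun Y _ _ g => univ_right (triB k A B M) Y g (fun z => z.fst.2)
      (by intro w; ext <;> simp [triB_apply, tri_left, tri_right]) (IB k A B M) hB
      (by
        intro z hz
        rw [mem_IB] at hz
        ext <;> simp [triB_apply, tri_left, tri_right, hz]))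
    (Tri A B M) B (LinearEquiv.ofBijective (uL (triB k A B M)) (uL_bij _
      (by
        intro x y hxy
        exact congrArg (fun z : Tri A B M => z.fst.2) hxy)
      (by
        intro z
        refine ⟨z.fst.2, ?_⟩
        ext <;> simp [triB_apply, tri_left, tri_right]))).symm (n+1)
  exact ⟨(e0.trans (e1.trans (LinearEquiv.prodCongr fA fB))).trans (LinearEquiv.prodCongr eA.symm eB.symm)⟩

end Part5

/-- if the corner bimodule `M` is projective over `B ⊗[k] Aᵐᵒᵖ`, then for the
triangular (null-square, `N = 0`) algebra `Λ = [[A,0],[M,B]]` and every `n ≥ 2`,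
`HH^n(Λ) ≅ HH^n(A) ⊕ HH^n(B)` as `k`-vector spaces. -/
theorem stmt_14 (hM : Module.Projective (B ⊗[k] Aᵐᵒᵖ) M) :
    ∀ n : ℕ, 2 ≤ n →
      Nonempty (HHt k (Tri A B M) n ≃ₗ[k] (HHt k A n × HHt k B n)) := by
  intro n hn
  obtain ⟨m, rfl⟩ : ∃ m, n = m + 2 := ⟨n - 2, by omega⟩
  exact final_aux k A B M hM m

end
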